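/- arXiv:2412.04499 — 9 statements merged into one kernel-verified Lean document; each statement's English description precedes it below -/
import Mathlib

section
/- Let X, U, Z be real Hilbert spaces, Z₁ ⊆ Z a linear subspace, and P, S : Z₁ → X and γ, β : Z₁ → U linear maps. Set Z₀ := {z ∈ Z₁ : γ z = 0 and β z = 0}, and define the minus pairing on X × U × X × U by ⟨⟨(x₁,χ₁,e₁,ε₁),(x₂,χ₂,e₂,ε₂)⟩⟩₋ := ⟨e₂,x₁⟩ − ⟨e₁,x₂⟩ + ⟨ε₂,χ₁⟩ − ⟨ε₁,χ₂⟩ (inner products of X and U). Assume: (symmetry) for all z₁, z₂ ∈ Z₁, ⟨β z₁, γ z₂⟩ + ⟨S z₁, P z₂⟩ = ⟨S z₂, P z₁⟩ + ⟨β z₂, γ z₁⟩; (maximality) for all x, e ∈ X, if ⟨S z₀, x⟩ − ⟨e, P z₀⟩ = 0 for every z₀ ∈ Z₀, then there exists z ∈ Z₁ with P z = x and S z = e; (density) the range of the map z ↦ (γ z, β z) is dense in U × U. Then the set L := {(P z, γ z, S z, β z) : z ∈ Z₁} satisfies L = {v ∈ X × U × X × U : ⟨⟨v, w⟩⟩₋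 = 0 for all w ∈ L}, i.e. L equals its own orthogonal with respect to the minus pairing. -/
open RealInnerProductSpace

/-- A Stokes-Lagrange structure (image of `z ↦ (P z, γ z, S z, β z)`) satisfying the
symmetry, maximality and density assumptions is a Lagrange structure: it equals its own
orthogonal with respect to the (augmented) minus pairing. -/
theorem stokesLagrange_is_lagrange
    {X U Z : Type*}
    [NormedAddCommGroup X] [InnerProductSpace ℝ X] [CompleteSpace X]
    [NormedAddCommGroup U] [InnerProductSpace ℝ U] [CompleteSpace U]
    [NormedAddCommGroup Z] [InnerProductSpace ℝ Z] [CompleteSpace Z]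
    (Z₁ : Submodule ℝ Z)
    (P S : Z₁ →ₗ[ℝ] X) (γ β : Z₁ →ₗ[ℝ] U)
    (hsym : ∀ z₁ z₂ : Z₁,
      ⟪β z₁, γ z₂⟫ + ⟪S z₁, P z₂⟫ = ⟪S z₂, P z₁⟫ + ⟪β z₂, γ z₁⟫)
    (hmax : ∀ x e : X,
      (∀ z₀ : Z₁, γ z₀ = 0 → β z₀ = 0 → ⟪S z₀, x⟫ - ⟪e, P z₀⟫ = 0) →
      ∃ z : Z₁, P z = x ∧ S z = e)
    (hdense : Dense (Set.range fun z : Z₁ => ((γ z, β z) : U × U))) :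
    {v : X × U × X × U | ∃ z : Z₁, v = (P z, γ z, S z, β z)} =
      {v : X × U × X × U |
        ∀ w ∈ {v : X × U × X × U | ∃ z : Z₁, v = (P z, γ z, S z, β z)},
          ⟪w.2.2.1, v.1⟫ - ⟪v.2.2.1, w.1⟫
            + ⟪w.2.2.2, v.2.1⟫ - ⟪v.2.2.2, w.2.1⟫ = 0} := by
  ext ⟨x, χ, e, ε⟩
  simp only [Set.mem_ofPred_eq]
  constructor
  · rintro ⟨z, hz⟩ w ⟨y, rfl⟩
    simp only [Prod.mk.injEq] at hz
    obtain ⟨rfl, rfl, rfl, rfl⟩ := hz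
    linarith [hsym y z]
  · intro h
    have horth (y : Z₁) : ⟪S y, x⟫ - ⟪e, P y⟫ + ⟪β y, χ⟫ - ⟪ε, γ y⟫ = 0 := h _ ⟨y, rfl⟩
    obtain ⟨z, rfl, rfl⟩ := hmax x e fun z₀ hγ hβ => by simpa [hγ, hβ] using horth z₀
    have hbdry : (fun p : U × U => ⟪p.2, χ - γ z⟫ - ⟪ε - β z, p.1⟫) = fun _ => 0 := by
      refine Continuous.ext_on hdense (by fun_prop) continuous_const ?_
      rintro _ ⟨y, rfl⟩
      simp only [inner_sub_left, inner_sub_right]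
      linarith [hsym y z, horth y]
    have hsq := congrFun hbdry (-(ε - β z), χ - γ z)
    simp only [inner_neg_right, real_inner_self_eq_norm_sq] at hsq
    have hχ : χ - γ z = 0 := norm_eq_zero.mp (by nlinarith [norm_nonneg (χ - γ z)])
    have hε : ε - β z = 0 := norm_eq_zero.mp (by nlinarith [norm_nonneg (ε - β z)])
    exact ⟨z, by rw [sub_eq_zero.mp hχ, sub_eq_zero.mp hε]⟩
end

section
/- Let Z and X be real Hilbert spaces and let p : Z → X be twice continuously (Fréchet) differentiable and s : Z → X be continuously (Fréchet) differentiable. Assume the Maxwell reciprocity condition: for all z, v, w ∈ Z, ⟨Ds(z)v, Dp(z)w⟩ = ⟨Dp(z)v, Ds(z)w⟩, where Ds(z) and Dp(z) are the Fréchet derivatives at z. Define H : Z → ℝ by H(z) := ∫₀¹ ⟨s(τ z), Dp(τ z)(z)⟩ dτ. Then H is Fréchet differentiable on Z and for all z, v ∈ Z, DH(z)(v) = ⟨s(z), Dp(z)(v)⟩. In particular, along any differentiable curve t ↦ z(t) in Z, (d/dt) H(z(t)) = ⟨s(z(t)), Dp(z(t))(ż(t))⟩. -/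
open RealInnerProductSpace intervalIntegral

/-- The `1`-form `⟨s, Dp⟩` is differentiable, with the derivative given by the product rule. -/
theorem hasFDerivAt_innerSL_comp_fderiv {Z X : Type*}
    [NormedAddCommGroup Z] [NormedSpace ℝ Z] [NormedAddCommGroup X] [InnerProductSpace ℝ X]
    {p s : Z → X} (hp : ContDiff ℝ 2 p) (hs : ContDiff ℝ 1 s) (z : Z) :
    ∃ ω' : Z →L[ℝ] Z →L[ℝ] ℝ,
      HasFDerivAt (fun y => (innerSL ℝ (s y)).comp (fderiv ℝ p y)) ω' z ∧
      ∀ u v, ω' u v = ⟪s z, fderiv ℝ (fderiv ℝ p) z u v⟫ + ⟪fderiv ℝ s z u, fderiv ℝ p z v⟫ := by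
  have hs' : HasFDerivAt (fun y => innerSL ℝ (s y)) ((innerSL ℝ).comp (fderiv ℝ s z)) z :=
    (innerSL ℝ).hasFDerivAt.comp z (hs.differentiable one_ne_zero z).hasFDerivAt
  have hp' : HasFDerivAt (fderiv ℝ p) (fderiv ℝ (fderiv ℝ p) z) z :=
    ((hp.fderiv_right (m := 1) (by norm_num)).differentiable one_ne_zero z).hasFDerivAt
  exact ⟨_, hs'.clm_comp hp', fun u v => by simp⟩

/-- Maxwell reciprocity conditions are sufficient for the existence of a Hamiltonian:
if `⟨Ds(z)v, Dp(z)w⟩ = ⟨Dp(z)v, Ds(z)w⟩` for all `z, v, w`, then the functional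
`H(z) := ∫₀¹ ⟨s(τz), Dp(τz)(z)⟩ dτ` is Fréchet differentiable with
`DH(z)(v) = ⟨s(z), Dp(z)(v)⟩`; in particular along differentiable curves
`(d/dt) H(z(t)) = ⟨s(z(t)), Dp(z(t))(ż(t))⟩`. -/
theorem maxwell_reciprocity_hamiltonian
    {Z X : Type*}
    [NormedAddCommGroup Z] [InnerProductSpace ℝ Z] [CompleteSpace Z]
    [NormedAddCommGroup X] [InnerProductSpace ℝ X] [CompleteSpace X]
    (p s : Z → X)
    (hp : ContDiff ℝ 2 p) (hs : ContDiff ℝ 1 s)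
    (hrec : ∀ z v w : Z,
      ⟪fderiv ℝ s z v, fderiv ℝ p z w⟫ = ⟪fderiv ℝ p z v, fderiv ℝ s z w⟫)
    (H : Z → ℝ)
    (hH : ∀ z : Z, H z = ∫ τ in (0:ℝ)..1, ⟪s (τ • z), fderiv ℝ p (τ • z) z⟫) :
    (∀ z : Z, HasFDerivAt H ((innerSL ℝ (s z)).comp (fderiv ℝ p z)) z) ∧
    (∀ (c c' : ℝ → Z) (t : ℝ), HasDerivAt c (c' t) t →
      HasDerivAt (fun u => H (c u)) ⟪s (c t), fderiv ℝ p (c t) (c' t)⟫ t) := by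
  have hH' : ∀ z : Z, HasFDerivAt H ((innerSL ℝ (s z)).comp (fderiv ℝ p z)) z := by
    choose ω' hω' hω'_apply using hasFDerivAt_innerSL_comp_fderiv hp hs
    have hsymm (z u v : Z) : ω' z u v = ω' z v u := by
      have hsnd : IsSymmSndFDerivAt ℝ p z := hp.contDiffAt.isSymmSndFDerivAt (by simp)
      rw [hω'_apply, hω'_apply, hsnd.eq u v, hrec z u v, real_inner_comm (fderiv ℝ s z v)]
    have hH_eq : H = fun z => curveIntegral (fun y => (innerSL ℝ (s y)).comp (fderiv ℝ p y))
        (Path.segment 0 z) := by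
      ext z
      simp [hH, curveIntegral_segment, AffineMap.lineMap_apply]
    intro z
    rw [hH_eq]
    exact (convex_univ.hasFDerivWithinAt_curveIntegral_segment_of_hasFDerivWithinAt_symmetric
      (fun x _ => (hω' x).hasFDerivWithinAt) (fun a _ x _ y _ => hsymm a x y)
      (Set.mem_univ 0) (Set.mem_univ z)).hasFDerivAt_of_univ
  exact ⟨hH', fun c c' t hc => (hH' (c t)).comp_hasDerivAt t hc⟩
end

section
/- Let H₁, H₂ and U be real Hilbert spaces, W ⊆ H₁ and W' ⊆ H₂ linear subspaces, and let K : W → H₂, K† : W' → H₁, γ : W → U, β : W' → U be linear maps satisfying the abstract Stokes identity: for all φ ∈ W and ψ ∈ W', ⟨K φ, ψ⟩ = ⟨φ, K† ψ⟩ + ⟨β ψ, γ φ⟩. Let η : H₂ → H₂ and κ : H₁ → H₁ be bounded self-adjoint linear maps. Define Z₁ := {(z₁, z₂) ∈ H₁ × H₁ : z₁ ∈ W and η(K z₁) ∈ W'}, and on Z₁ the maps S(z₁,z₂) := (K†(η(K z₁)), κ z₂), γ̃(z₁,z₂) := γ(z₁), β̃(z₁,z₂) := β(η(K z₁)). Then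 the quadruple (Id, γ̃, S, β̃) satisfies the symmetry identity: for all z, z' ∈ Z₁, ⟨β̃ z, γ̃ z'⟩ + ⟨S z, z'⟩ = ⟨S z', z⟩ + ⟨β̃ z', γ̃ z⟩, where ⟨S z, z'⟩ denotes the inner product in H₁ × H₁. -/
open RealInnerProductSpace

/-- Symmetry lemma for the Stokes-Lagrange representation of the wave-like system:
given the abstract Stokes identity `⟨Kφ, ψ⟩ = ⟨φ, K†ψ⟩ + ⟨βψ, γφ⟩` and bounded
self-adjoint `η, κ`, the quadruple `(Id, γ̃, S, β̃)` with
`S(z₁,z₂) = (K†(η(K z₁)), κ z₂)`, `γ̃(z₁,z₂) = γ z₁`, `β̃(z₁,z₂) = β(η(K z₁))`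
satisfies `⟨β̃ z, γ̃ z'⟩ + ⟨S z, z'⟩ = ⟨S z', z⟩ + ⟨β̃ z', γ̃ z⟩`. -/
theorem wave_like_system_symmetry
    {H₁ H₂ U : Type*}
    [NormedAddCommGroup H₁] [InnerProductSpace ℝ H₁] [CompleteSpace H₁]
    [NormedAddCommGroup H₂] [InnerProductSpace ℝ H₂] [CompleteSpace H₂]
    [NormedAddCommGroup U] [InnerProductSpace ℝ U] [CompleteSpace U]
    (W : Submodule ℝ H₁) (W' : Submodule ℝ H₂)
    (K : W →ₗ[ℝ] H₂) (Kd : W' →ₗ[ℝ] H₁)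
    (γ : W →ₗ[ℝ] U) (β : W' →ₗ[ℝ] U)
    (hStokes : ∀ (φ : W) (ψ : W'),
      ⟪K φ, (ψ : H₂)⟫ = ⟪(φ : H₁), Kd ψ⟫ + ⟪β ψ, γ φ⟫)
    (η : H₂ →L[ℝ] H₂) (κ : H₁ →L[ℝ] H₁)
    (hη : ∀ u v : H₂, ⟪η u, v⟫ = ⟪u, η v⟫)
    (hκ : ∀ u v : H₁, ⟪κ u, v⟫ = ⟪u, κ v⟫) :
    ∀ (z₁ : W) (z₂ : H₁) (h : η (K z₁) ∈ W')
      (z₁' : W) (z₂' : H₁) (h' : η (K z₁') ∈ W'),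
      ⟪β ⟨η (K z₁), h⟩, γ z₁'⟫
        + (⟪Kd ⟨η (K z₁), h⟩, (z₁' : H₁)⟫ + ⟪κ z₂, z₂'⟫)
      = (⟪Kd ⟨η (K z₁'), h'⟩, (z₁ : H₁)⟫ + ⟪κ z₂', z₂⟫)
        + ⟪β ⟨η (K z₁'), h'⟩, γ z₁⟫ := by
  intro z₁ z₂ h z₁' z₂' h'
  have stokes := hStokes z₁' ⟨η (K z₁), h⟩
  have stokes' := hStokes z₁ ⟨η (K z₁'), h'⟩
  have K_symm : ⟪K z₁', η (K z₁)⟫ = ⟪K z₁, η (K z₁')⟫ := by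
    rw [← hη, real_inner_comm]
  have κ_symm : ⟪κ z₂, z₂'⟫ = ⟪κ z₂', z₂⟫ := by
    rw [hκ, real_inner_comm]
  rw [real_inner_comm (z₁' : H₁), real_inner_comm (z₁ : H₁)]
  linarith
end

section
/- Let a < b be real numbers, let E, ρ : [a,b] → ℝ be continuously differentiable with ρ(x) > 0 on [a,b], and let w, p : ℝ × [a,b] → ℝ be twice continuously differentiable and satisfy, for all t and all x ∈ [a,b], ∂ₜ w(t,x) = p(t,x)/ρ(x) and ∂ₜ p(t,x) = ∂ₓ(E ∂ₓ w)(t,x). Then the Hamiltonian H(t) := (1/2) ∫ₐᵇ ( p(t,x)²/ρ(x) + E(x) (∂ₓ w(t,x))² ) dx is differentiable in t and H'(t) = (∂ₜ w)(t,b) · E(b) (∂ₓ w)(t,b) − (∂ₜ w)(t,a) · E(a) (∂ₓ w)(t,a). -/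
open Set MeasureTheory intervalIntegral

/-- Restricting a function differentiable within a strip to a vertical segment. -/
theorem HasFDerivWithinAt.hasDerivWithinAt_prodMk_left {V : Type*} [NormedAddCommGroup V]
    [NormedSpace ℝ V] {f : ℝ × ℝ → V} {f' : ℝ × ℝ →L[ℝ] V} {K : Set ℝ} {t x : ℝ}
    (hf : HasFDerivWithinAt f f' (univ ×ˢ K) (t, x)) :
    HasDerivWithinAt (fun y => f (t, y)) (f' (0, 1)) K x :=
  hf.comp_hasDerivWithinAt (f := fun y : ℝ => (t, y)) x
    ((hasDerivWithinAt_const x K t).prodMk (hasDerivWithinAt_id x K))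
    (fun _ hy => ⟨mem_univ _, hy⟩)

/-- Restricting a function differentiable within a strip to a horizontal line. -/
theorem HasFDerivWithinAt.hasDerivAt_prodMk_right {V : Type*} [NormedAddCommGroup V]
    [NormedSpace ℝ V] {f : ℝ × ℝ → V} {f' : ℝ × ℝ →L[ℝ] V} {K : Set ℝ} {t x : ℝ}
    (hf : HasFDerivWithinAt f f' (univ ×ˢ K) (t, x)) (hx : x ∈ K) :
    HasDerivAt (fun s => f (s, x)) (f' (1, 0)) t :=
  hf.comp_hasDerivAt (f := fun s : ℝ => (s, x)) t
    ((hasDerivAt_id t).prodMk (hasDerivAt_const t x))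
    (Filter.Eventually.of_forall fun _ => ⟨mem_univ _, hx⟩)

theorem uniqueDiffOn_univ_prod_Icc {a b : ℝ} (hab : a < b) :
    UniqueDiffOn ℝ ((univ : Set ℝ) ×ˢ Icc a b) :=
  uniqueDiffOn_univ.prod (uniqueDiffOn_Icc hab)

theorem continuousOn_Icc_of_continuousOn_univ_prod {V : Type*} [TopologicalSpace V] {K : Set ℝ}
    {f : ℝ × ℝ → V} (hf : ContinuousOn f (univ ×ˢ K)) (t : ℝ) :
    ContinuousOn (fun x => f (t, x)) K :=
  hf.comp (f := fun x : ℝ => (t, x)) (by fun_prop) (fun _ hx => ⟨mem_univ _, hx⟩)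

/-- Differentiation under the integral sign over a compact interval, for an integrand whose
parameter derivative is jointly continuous. -/
theorem hasDerivAt_intervalIntegral_of_continuousOn {a b : ℝ} (hab : a ≤ b) {F F' : ℝ → ℝ → ℝ}
    (hF : ∀ t, ContinuousOn (F t) (Icc a b))
    (hF' : ContinuousOn (fun q : ℝ × ℝ => F' q.1 q.2) (univ ×ˢ Icc a b))
    (hderiv : ∀ t, ∀ x ∈ Icc a b, HasDerivAt (fun s => F s x) (F' t x) t) (t : ℝ) :
    HasDerivAt (fun s => ∫ x in a..b, F s x) (∫ x in a..b, F' t x) t := by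
  obtain ⟨C, hC⟩ := (isCompact_Icc.prod isCompact_Icc).exists_bound_of_continuousOn
    (hF'.mono (prod_mono_left (subset_univ (Icc (t - 1) (t + 1)))))
  have hsub : uIoc a b ⊆ Icc a b := by
    rw [uIoc_of_le hab]
    exact Ioc_subset_Icc_self
  have hint : ∀ s, IntervalIntegrable (F s) volume a b := fun s =>
    (hF s).intervalIntegrable_of_Icc hab
  have hint' : IntervalIntegrable (F' t) volume a b :=
    (continuousOn_Icc_of_continuousOn_univ_prod hF' t).intervalIntegrable_of_Icc hab
  refine (intervalIntegral.hasDerivAt_integral_of_dominated_loc_of_deriv_le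
    (bound := fun _ => C) (Icc_mem_nhds (by linarith : t - 1 < t) (by linarith : t < t + 1))
    (Filter.Eventually.of_forall fun s => (hint s).def'.aestronglyMeasurable) (hint t)
    hint'.def'.aestronglyMeasurable
    (Filter.Eventually.of_forall fun x hx s hs => hC (s, x) ⟨hs, hsub hx⟩)
    intervalIntegrable_const
    (Filter.Eventually.of_forall fun x hx s _ => hderiv s x (hsub hx))).2

/-- For a `C²` function `w` on a strip, the mixed derivatives `∂ₜ∂ₓw` and `∂ₓ∂ₜw` exist, agree and
are continuous up to the boundary. -/
theorem ContDiffOn.exists_mixed_deriv {a b : ℝ} (hab : a < b) {w v : ℝ → ℝ → ℝ}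
    (hw : ContDiffOn ℝ 2 (fun q : ℝ × ℝ => w q.1 q.2) (univ ×ˢ Icc a b))
    (hv : ∀ t, ∀ x ∈ Icc a b, HasDerivAt (fun s => w s x) (v t x) t) :
    ContDiffOn ℝ 1 (fun q : ℝ × ℝ => derivWithin (w q.1) (Icc a b) q.2) (univ ×ˢ Icc a b) ∧
    ∃ m : ℝ × ℝ → ℝ, ContinuousOn m (univ ×ˢ Icc a b) ∧
      ∀ t, ∀ x ∈ Icc a b,
        HasDerivAt (fun s => derivWithin (w s) (Icc a b) x) (m (t, x)) t ∧
        HasDerivWithinAt (v t) (m (t, x)) (Icc a b) x := by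
  set S : Set (ℝ × ℝ) := univ ×ˢ Icc a b with hS
  set W : ℝ × ℝ → ℝ := fun q => w q.1 q.2
  have hSu : UniqueDiffOn ℝ S := uniqueDiffOn_univ_prod_Icc hab
  set G := fderivWithin ℝ W S
  have hG1 : ContDiffOn ℝ 1 G S := hw.fderivWithin hSu (by norm_num)
  have hWd : ∀ q ∈ S, HasFDerivWithinAt W (G q) S q := fun q hq =>
    ((hw.differentiableOn (by norm_num)) q hq).hasFDerivWithinAt
  have hGd : ∀ q ∈ S, HasFDerivWithinAt G (fderivWithin ℝ G S q) S q := fun q hq =>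
    ((hG1.differentiableOn (by norm_num)) q hq).hasFDerivWithinAt
  have hmem : ∀ t, ∀ x ∈ Icc a b, (t, x) ∈ S := fun t x hx => ⟨mem_univ t, hx⟩
  have hwx : ∀ t, ∀ x ∈ Icc a b, derivWithin (w t) (Icc a b) x = G (t, x) (0, 1) :=
    fun t x hx => (hWd _ (hmem t x hx)).hasDerivWithinAt_prodMk_left.derivWithin
      (uniqueDiffOn_Icc hab x hx)
  have hwt : ∀ t, ∀ x ∈ Icc a b, v t x = G (t, x) (1, 0) := fun t x hx =>
    (hv t x hx).unique ((hWd _ (hmem t x hx)).hasDerivAt_prodMk_right hx)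
  have hsymm : ∀ q ∈ S, IsSymmSndFDerivWithinAt ℝ W S q := fun q hq => by
    refine (hw q hq).isSymmSndFDerivWithinAt (by simp) hSu ?_ hq
    rw [hS, interior_prod_eq, interior_univ, interior_Icc, closure_prod_eq, closure_univ,
      closure_Ioo hab.ne]
    exact hq
  refine ⟨(hG1.clm_apply contDiffOn_const).congr fun q hq => hwx q.1 q.2 hq.2,
    fun q => fderivWithin ℝ G S q (1, 0) (0, 1), ?_, fun t x hx => ⟨?_, ?_⟩⟩
  · exact ((hG1.continuousOn_fderivWithin hSu le_rfl).clm_apply continuousOn_const).clm_apply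
      continuousOn_const
  · have h := ((hGd _ (hmem t x hx)).hasDerivAt_prodMk_right hx).clm_apply
      (hasDerivAt_const t ((0, 1) : ℝ × ℝ))
    simp only [map_zero, add_zero] at h
    simpa only [hwx _ x hx] using h
  · have h := (hGd _ (hmem t x hx)).hasDerivWithinAt_prodMk_left.clm_apply
      (hasDerivWithinAt_const x (Icc a b) ((1, 0) : ℝ × ℝ))
    simp only [map_zero, add_zero] at h
    exact (h.congr (fun y hy => hwt t y hy) (hwt t x hx)).congr_deriv
      (hsymm _ (hmem t x hx) _ _)

/-- Power balance for the 1D linear wave equation in Stokes-Lagrange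
(displacement–momentum) representation: if `∂ₜw = p/ρ` and `∂ₜp = ∂ₓ(E ∂ₓw)` on `[a,b]`,
then the Hamiltonian `H(t) = (1/2)∫ₐᵇ (p²/ρ + E(∂ₓw)²) dx` satisfies
`H'(t) = (∂ₜw)(t,b)·E(b)(∂ₓw)(t,b) − (∂ₜw)(t,a)·E(a)(∂ₓw)(t,a)`. -/
theorem wave1D_power_balance_stokes_lagrange
    (a b : ℝ) (hab : a < b)
    (E ρ : ℝ → ℝ)
    (hE : ContDiffOn ℝ 1 E (Icc a b))
    (hρ : ContDiffOn ℝ 1 ρ (Icc a b))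
    (hρpos : ∀ x ∈ Icc a b, 0 < ρ x)
    (w p : ℝ → ℝ → ℝ)
    (hw : ContDiffOn ℝ 2 (fun q : ℝ × ℝ => w q.1 q.2) (univ ×ˢ Icc a b))
    (hp : ContDiffOn ℝ 2 (fun q : ℝ × ℝ => p q.1 q.2) (univ ×ˢ Icc a b))
    (heq1 : ∀ t : ℝ, ∀ x ∈ Icc a b,
      HasDerivAt (fun s => w s x) (p t x / ρ x) t)
    (heq2 : ∀ t : ℝ, ∀ x ∈ Icc a b,
      HasDerivAt (fun s => p s x)
        (derivWithin (fun y => E y * derivWithin (fun z => w t z) (Icc a b) y) (Icc a b) x) t) :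
    ∀ t : ℝ,
      HasDerivAt
        (fun s => (1/2) * ∫ x in a..b,
          ((p s x)^2 / ρ x + E x * (derivWithin (fun z => w s z) (Icc a b) x)^2))
        (deriv (fun s => w s b) t * (E b * derivWithin (fun z => w t z) (Icc a b) b)
          - deriv (fun s => w s a) t * (E a * derivWithin (fun z => w t z) (Icc a b) a)) t := by
  intro t
  obtain ⟨hwx, m, hm, hmd⟩ := hw.exists_mixed_deriv hab heq1
  set wx : ℝ → ℝ → ℝ := fun s x => derivWithin (w s) (Icc a b) x with hwx_def
  set σ : ℝ → ℝ → ℝ := fun s x => derivWithin (fun y => E y * wx s y) (Icc a b) x with hσ_def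
  have hsnd : MapsTo (Prod.snd : ℝ × ℝ → ℝ) (univ ×ˢ Icc a b) (Icc a b) := fun q hq => hq.2
  have hEc : ContinuousOn (fun q : ℝ × ℝ => E q.2) (univ ×ˢ Icc a b) :=
    hE.continuousOn.comp continuousOn_snd hsnd
  have hρc : ContinuousOn (fun q : ℝ × ℝ => ρ q.2) (univ ×ˢ Icc a b) :=
    hρ.continuousOn.comp continuousOn_snd hsnd
  have hρ0 : ∀ q ∈ (univ : Set ℝ) ×ˢ Icc a b, ρ q.2 ≠ 0 := fun q hq => (hρpos _ hq.2).ne'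
  have hσc : ContinuousOn (fun q : ℝ × ℝ => σ q.1 q.2) (univ ×ˢ Icc a b) := by
    refine ((hp.continuousOn_fderivWithin (uniqueDiffOn_univ_prod_Icc hab)
      (by norm_num)).clm_apply (continuousOn_const (c := ((1, 0) : ℝ × ℝ)))).congr fun q hq => ?_
    exact (heq2 q.1 q.2 hq.2).unique
      (((hp.differentiableOn (by norm_num)) q hq).hasFDerivWithinAt.hasDerivAt_prodMk_right hq.2)
  have hσd : ∀ x ∈ Icc a b, HasDerivWithinAt (fun y => E y * wx t y) (σ t x) (Icc a b) x := by
    intro x hx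
    have hwxd := ((hwx.differentiableOn (by norm_num))
      (t, x) ⟨mem_univ t, hx⟩).hasFDerivWithinAt.hasDerivWithinAt_prodMk_left
    exact (((hE.differentiableOn (by norm_num)) x hx).mul
      hwxd.differentiableWithinAt).hasDerivWithinAt
  have hfluxd : ∀ x ∈ Icc a b, HasDerivWithinAt (fun y => p t y / ρ y * (E y * wx t y))
      (m (t, x) * (E x * wx t x) + p t x / ρ x * σ t x) (Icc a b) x :=
    fun x hx => (hmd t x hx).2.mul (hσd x hx)
  have hrate : ContinuousOn (fun q : ℝ × ℝ =>
      2 * (m q * (E q.2 * wx q.1 q.2) + p q.1 q.2 / ρ q.2 * σ q.1 q.2)) (univ ×ˢ Icc a b) :=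
    continuousOn_const.mul ((hm.mul (hEc.mul hwx.continuousOn)).add
      ((hp.continuousOn.div hρc hρ0).mul hσc))
  have hdensity : ContinuousOn (fun q : ℝ × ℝ =>
      (p q.1 q.2) ^ 2 / ρ q.2 + E q.2 * (wx q.1 q.2) ^ 2) (univ ×ˢ Icc a b) :=
    ((hp.continuousOn.pow 2).div hρc hρ0).add (hEc.mul (hwx.continuousOn.pow 2))
  have hleibniz := hasDerivAt_intervalIntegral_of_continuousOn hab.le
    (F := fun s x => (p s x) ^ 2 / ρ x + E x * (wx s x) ^ 2)
    (F' := fun s x => 2 * (m (s, x) * (E x * wx s x) + p s x / ρ x * σ s x))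
    (continuousOn_Icc_of_continuousOn_univ_prod hdensity) hrate
    (fun s x hx => by
      refine ((((heq2 s x hx).pow 2).div_const (ρ x)).add
        ((((hmd s x hx).1).pow 2).const_mul (E x))).congr_deriv ?_
      simp only [hσ_def, hwx_def]
      push_cast
      ring) t
  have hflux := integral_eq_sub_of_hasDerivAt_of_le hab.le
    (fun x hx => (hfluxd x hx).continuousWithinAt)
    (fun x hx => (hfluxd x (Ioo_subset_Icc_self hx)).hasDerivAt (Icc_mem_nhds hx.1 hx.2))
    (((continuousOn_Icc_of_continuousOn_univ_prod hrate t).const_mul (1 / 2)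
      |>.congr fun x _ => by simp).intervalIntegrable_of_Icc hab.le)
  rw [(heq1 t b (right_mem_Icc.2 hab.le)).deriv, (heq1 t a (left_mem_Icc.2 hab.le)).deriv]
  refine (hleibniz.const_mul (1 / 2)).congr_deriv ?_
  rw [intervalIntegral.integral_const_mul, hflux]
  ring
end

section
/- Let μ > 0 and E ∈ ℝ, and let ε : ℝ → ℝ be continuous and compactly supported. Define the kernel α(x) := (1/(2√μ)) exp(−|x|/√μ) and the nonlocal stress σ : ℝ → ℝ by σ(x) := ∫_ℝ α(x − x') E ε(x') dx'. Then σ is twice differentiable on ℝ and satisfies, for every x ∈ ℝ, σ(x) − μ σ''(x) = E ε(x). -/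
open MeasureTheory

theorem hasDerivAt_integral_Iic {g : ℝ → ℝ} (hg : Continuous g) (hi : Integrable g) (x : ℝ) :
    HasDerivAt (fun t => ∫ y in Set.Iic t, g y) (g x) x := by
  have h : (fun t => ∫ y in Set.Iic t, g y) =
      fun t => (∫ y in Set.Iic (0 : ℝ), g y) + ∫ y in (0 : ℝ)..t, g y := by
    funext t
    rw [← intervalIntegral.integral_Iic_sub_Iic hi.integrableOn hi.integrableOn]
    ring
  rw [h]
  exact (hg.integral_hasStrictDerivAt 0 x).hasDerivAt.const_add _

theorem hasDerivAt_integral_Ioi {g : ℝ → ℝ} (hg : Continuous g) (hi : Integrable g) (x : ℝ) :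
    HasDerivAt (fun t => ∫ y in Set.Ioi t, g y) (-g x) x := by
  have h : (fun t => ∫ y in Set.Ioi t, g y) =
      fun t => (∫ y, g y) - ∫ y in Set.Iic t, g y := by
    funext t
    rw [← intervalIntegral.integral_Iic_add_Ioi hi.integrableOn hi.integrableOn (b := t)]
    ring
  rw [h]
  exact (hasDerivAt_integral_Iic hg hi x).const_sub _

/-- Splitting the convolution with `e^{-k|x|}` at the kink of the kernel. -/
theorem integral_exp_neg_abs_mul {f : ℝ → ℝ} (hf : Continuous f) (hs : HasCompactSupport f)
    (k x : ℝ) :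
    ∫ y, Real.exp (-(k * |x - y|)) * f y =
      Real.exp (-(k * x)) * (∫ y in Set.Iic x, Real.exp (k * y) * f y) +
      Real.exp (k * x) * ∫ y in Set.Ioi x, Real.exp (-(k * y)) * f y := by
  have hi : Integrable fun y => Real.exp (-(k * |x - y|)) * f y :=
    Continuous.integrable_of_hasCompactSupport (by fun_prop) hs.mul_left
  rw [← intervalIntegral.integral_Iic_add_Ioi hi.integrableOn hi.integrableOn (b := x),
    ← integral_const_mul, ← integral_const_mul]
  congr 1
  · refine setIntegral_congr_fun measurableSet_Iic fun y hy => ?_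
    have hy : y ≤ x := hy
    rw [abs_of_nonneg (sub_nonneg.2 hy), ← mul_assoc, ← Real.exp_add]
    ring_nf
  · refine setIntegral_congr_fun measurableSet_Ioi fun y hy => ?_
    have hy : x < y := hy
    rw [abs_of_neg (sub_neg.2 hy), ← mul_assoc, ← Real.exp_add]
    ring_nf

/-- Eringen's equivalence between the explicit nonlocal constitutive law
`σ = α ∗ (Eε)` with exponential kernel `α(x) = (1/(2√μ)) e^{−|x|/√μ}` and the implicit
local law `(1 − μ∂²ₓ)σ = Eε`: the kernel is the Green's function of `1 − μ∂²ₓ` on `ℝ`. -/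
theorem eringen_kernel_greens_function
    (μ : ℝ) (hμ : 0 < μ) (E : ℝ)
    (ε : ℝ → ℝ) (hε : Continuous ε) (hsupp : HasCompactSupport ε) :
    let α : ℝ → ℝ := fun x => (1 / (2 * Real.sqrt μ)) * Real.exp (-|x| / Real.sqrt μ)
    let σ : ℝ → ℝ := fun x => ∫ x' : ℝ, α (x - x') * (E * ε x')
    (∀ x : ℝ, DifferentiableAt ℝ σ x) ∧
    (∀ x : ℝ, DifferentiableAt ℝ (deriv σ) x) ∧
    (∀ x : ℝ, σ x - μ * deriv (deriv σ) x = E * ε x) := by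
  intro α σ
  obtain ⟨k, hk⟩ : ∃ k, k = (Real.sqrt μ)⁻¹ := ⟨_, rfl⟩
  have hμk : μ * k ^ 2 = 1 := by
    rw [hk, inv_pow, Real.sq_sqrt hμ.le, mul_inv_cancel₀ hμ.ne']
  let f : ℝ → ℝ := fun y => E * ε y
  have hf : Continuous f := by fun_prop
  have hs : HasCompactSupport f := hsupp.mul_left
  let A : ℝ → ℝ := fun x => ∫ y in Set.Iic x, Real.exp (k * y) * f y
  let B : ℝ → ℝ := fun x => ∫ y in Set.Ioi x, Real.exp (-(k * y)) * f y
  have hA (x : ℝ) : HasDerivAt A (Real.exp (k * x) * f x) x :=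
    hasDerivAt_integral_Iic (g := fun y => Real.exp (k * y) * f y) (by fun_prop)
      (Continuous.integrable_of_hasCompactSupport (by fun_prop) hs.mul_left) x
  have hB (x : ℝ) : HasDerivAt B (-(Real.exp (-(k * x)) * f x)) x :=
    hasDerivAt_integral_Ioi (g := fun y => Real.exp (-(k * y)) * f y) (by fun_prop)
      (Continuous.integrable_of_hasCompactSupport (by fun_prop) hs.mul_left) x
  have hp (x : ℝ) : HasDerivAt (fun t => Real.exp (k * t)) (Real.exp (k * x) * k) x := by
    simpa using ((hasDerivAt_id x).const_mul k).exp
  have hm (x : ℝ) : HasDerivAt (fun t => Real.exp (-(k * t))) (Real.exp (-(k * x)) * -k) x := by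
    simpa using ((hasDerivAt_id x).const_mul k).neg.exp
  have hσ : σ = fun x => k / 2 * (Real.exp (-(k * x)) * A x + Real.exp (k * x) * B x) := by
    funext x
    change _ = k / 2 * (Real.exp (-(k * x)) * (∫ y in Set.Iic x, Real.exp (k * y) * f y) +
      Real.exp (k * x) * ∫ y in Set.Ioi x, Real.exp (-(k * y)) * f y)
    rw [← integral_exp_neg_abs_mul hf hs, ← integral_const_mul]
    refine integral_congr_ae (.of_forall fun y => ?_)
    have he : -|x - y| / Real.sqrt μ = -(k * |x - y|) := by rw [hk]; ring
    simp only [α, f, he]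
    rw [hk]
    ring
  have hexp (x : ℝ) : Real.exp (-(k * x)) * Real.exp (k * x) = 1 := by
    rw [← Real.exp_add, neg_add_cancel, Real.exp_zero]
  have h1 (x : ℝ) : HasDerivAt σ
      (k ^ 2 / 2 * (Real.exp (k * x) * B x - Real.exp (-(k * x)) * A x)) x := by
    rw [hσ]
    refine ((((hm x).mul (hA x)).add ((hp x).mul (hB x))).const_mul (k / 2)).congr_deriv ?_
    ring
  have hd : deriv σ =
      fun x => k ^ 2 / 2 * (Real.exp (k * x) * B x - Real.exp (-(k * x)) * A x) :=
    funext fun x => (h1 x).deriv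
  have h2 (x : ℝ) : HasDerivAt (deriv σ) (k ^ 2 * (σ x - f x)) x := by
    rw [hd, hσ]
    refine ((((hp x).mul (hB x)).sub ((hm x).mul (hA x))).const_mul (k ^ 2 / 2)).congr_deriv ?_
    linear_combination (-(k ^ 2 * f x)) * hexp x
  refine ⟨fun x => (h1 x).differentiableAt, fun x => (h2 x).differentiableAt, fun x => ?_⟩
  rw [(h2 x).deriv]
  linear_combination (f x - σ x) * hμk
end

section
/- Let X, U, Z be real Hilbert spaces, Z₁ ⊆ Z a linear subspace, and P, S : Z₁ → X, γ, β : Z₁ → U linear maps satisfying the symmetry identity: for all z₁, z₂ ∈ Z₁, ⟨β z₁, γ z₂⟩ + ⟨S z₁, P z₂⟩ = ⟨S z₂, P z₁⟩ + ⟨β z₂, γ z₁⟩. Let z, ż : ℝ → Z₁ be curves such that the maps t ↦ P z(t), S z(t), γ z(t), β z(t) are differentiable with respective derivatives P ż(t), S ż(t), γ ż(t), β ż(t). Then the Hamiltonian H(t) := (1/2)⟨S z(t), P z(t)⟩ + (1/2)⟨β z(t), γ z(t)⟩ is differentiable in t with H'(t) = ⟨S z(t), P ż(t)⟩ + ⟨β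 z(t), γ ż(t)⟩. -/
open RealInnerProductSpace

/-- Power balance for a port-Hamiltonian system defined on a Stokes-Lagrange structure:
under the symmetry identity for `(P, γ, S, β)`, along any trajectory the Hamiltonian
`H(t) = (1/2)⟨S z(t), P z(t)⟩ + (1/2)⟨β z(t), γ z(t)⟩` satisfies
`H'(t) = ⟨S z(t), P ż(t)⟩ + ⟨β z(t), γ ż(t)⟩`. -/
theorem stokes_lagrange_power_balance
    {X U Z : Type*}
    [NormedAddCommGroup X] [InnerProductSpace ℝ X] [CompleteSpace X]
    [NormedAddCommGroup U] [InnerProductSpace ℝ U] [CompleteSpace U]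
    [NormedAddCommGroup Z] [InnerProductSpace ℝ Z] [CompleteSpace Z]
    (Z₁ : Submodule ℝ Z)
    (P S : Z₁ →ₗ[ℝ] X) (γ β : Z₁ →ₗ[ℝ] U)
    (hsym : ∀ z₁ z₂ : Z₁,
      ⟪β z₁, γ z₂⟫ + ⟪S z₁, P z₂⟫ = ⟪S z₂, P z₁⟫ + ⟪β z₂, γ z₁⟫)
    (z z' : ℝ → Z₁)
    (hP : ∀ t : ℝ, HasDerivAt (fun u => P (z u)) (P (z' t)) t)
    (hS : ∀ t : ℝ, HasDerivAt (fun u => S (z u)) (S (z' t)) t)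
    (hγ : ∀ t : ℝ, HasDerivAt (fun u => γ (z u)) (γ (z' t)) t)
    (hβ : ∀ t : ℝ, HasDerivAt (fun u => β (z u)) (β (z' t)) t) :
    ∀ t : ℝ,
      HasDerivAt (fun u => (1/2) * ⟪S (z u), P (z u)⟫ + (1/2) * ⟪β (z u), γ (z u)⟫)
        (⟪S (z t), P (z' t)⟫ + ⟪β (z t), γ (z' t)⟫) t := by
  intro t
  have hSP := ((hS t).inner ℝ (hP t)).const_mul (1 / 2 : ℝ)
  have hβγ := ((hβ t).inner ℝ (hγ t)).const_mul (1 / 2 : ℝ)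
  refine (hSP.add hβγ).congr_deriv ?_
  linarith [hsym (z t) (z' t)]
end

section
/- Let X, U, Z be real Hilbert spaces, Z₁ ⊆ Z a linear subspace, and P, S : Z₁ → X, γ, β : Z₁ → U linear maps satisfying the symmetry identity: for all z₁, z₂ ∈ Z₁, ⟨β z₁, γ z₂⟩ + ⟨S z₁, P z₂⟩ = ⟨S z₂, P z₁⟩ + ⟨β z₂, γ z₁⟩. Let z, ż : ℝ → Z₁ be curves such that the maps t ↦ P z(t), S z(t), γ z(t), β z(t) are differentiable with respective derivatives P ż(t), S ż(t), γ ż(t), β ż(t). Then the Legendre-transformed Hamiltonian H̃(t) := (1/2)⟨S z(t), P z(t)⟩ − (1/2)⟨β z(t), γ z(t)⟩ is differentiable in t with H̃'(t) = ⟨S z(t), P ż(t)⟩ − ⟨β ż(t), γ z(t)⟩. -/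
open RealInnerProductSpace

/-- Power balance for the Legendre-transformed Hamiltonian of a port-Hamiltonian system
on a Stokes-Lagrange structure: under the symmetry identity for `(P, γ, S, β)`,
`H̃(t) = (1/2)⟨S z(t), P z(t)⟩ − (1/2)⟨β z(t), γ z(t)⟩` satisfies
`H̃'(t) = ⟨S z(t), P ż(t)⟩ − ⟨β ż(t), γ z(t)⟩`. -/
theorem stokes_lagrange_legendre_power_balance
    {X U Z : Type*}
    [NormedAddCommGroup X] [InnerProductSpace ℝ X] [CompleteSpace X]
    [NormedAddCommGroup U] [InnerProductSpace ℝ U] [CompleteSpace U]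
    [NormedAddCommGroup Z] [InnerProductSpace ℝ Z] [CompleteSpace Z]
    (Z₁ : Submodule ℝ Z)
    (P S : Z₁ →ₗ[ℝ] X) (γ β : Z₁ →ₗ[ℝ] U)
    (hsym : ∀ z₁ z₂ : Z₁,
      ⟪β z₁, γ z₂⟫ + ⟪S z₁, P z₂⟫ = ⟪S z₂, P z₁⟫ + ⟪β z₂, γ z₁⟫)
    (z z' : ℝ → Z₁)
    (hP : ∀ t : ℝ, HasDerivAt (fun u => P (z u)) (P (z' t)) t)
    (hS : ∀ t : ℝ, HasDerivAt (fun u => S (z u)) (S (z' t)) t)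
    (hγ : ∀ t : ℝ, HasDerivAt (fun u => γ (z u)) (γ (z' t)) t)
    (hβ : ∀ t : ℝ, HasDerivAt (fun u => β (z u)) (β (z' t)) t) :
    ∀ t : ℝ,
      HasDerivAt (fun u => (1/2) * ⟪S (z u), P (z u)⟫ - (1/2) * ⟪β (z u), γ (z u)⟫)
        (⟪S (z t), P (z' t)⟫ - ⟪β (z' t), γ (z t)⟫) t := by
  intro t
  have h := (((hS t).inner ℝ (hP t)).const_mul (1/2 : ℝ)).sub
    (((hβ t).inner ℝ (hγ t)).const_mul (1/2 : ℝ))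
  refine h.congr_deriv ?_
  linarith [hsym (z t) (z' t)]
end

section
/- Let Y be a real Hilbert space and let χ¹, χ² : ℝ → Y be differentiable curves. Let H¹, H² : ℝ → ℝ be differentiable functions and ε¹, ε², ν¹, ν² : ℝ → Y maps such that (Hⁱ)'(t) = ⟨εⁱ(t), (χⁱ)'(t)⟩ for i = 1, 2 and all t. Let φ_T : Y × Y → ℝ be Fréchet differentiable, and denote by ∇₁φ_T(a,b), ∇₂φ_T(a,b) ∈ Y the partial gradients, i.e. Dφ_T(a,b)(v,w) = ⟨∇₁φ_T(a,b), v⟩ + ⟨∇₂φ_T(a,b), w⟩. Assume the interconnection law εⁱ(t) = −∇ᵢφ_T(χ¹(t), χ²(t)) + νⁱ(t) for i = 1, 2. Then the total Hamiltonian H̃(t) := H¹(t) + H²(t) + φ_T(χ¹(t), χ²(t)) is differentiable with H̃'(t) = ⟨ν¹(t), (χ¹)'(t)⟩ + ⟨ν²(t), (χ²)'(t)⟩. -/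
open RealInnerProductSpace

/-- Power balance for the interconnection of two passive systems through their boundary
energy ports: if `(Hⁱ)' = ⟨εⁱ, (χⁱ)'⟩` and the interconnection law
`εⁱ = −∇ᵢφ_T(χ¹, χ²) + νⁱ` holds, then the total Hamiltonian
`H̃ = H¹ + H² + φ_T(χ¹, χ²)` satisfies `H̃' = ⟨ν¹, (χ¹)'⟩ + ⟨ν², (χ²)'⟩`. -/
theorem energy_port_interconnection_power_balance
    {Y : Type*} [NormedAddCommGroup Y] [InnerProductSpace ℝ Y] [CompleteSpace Y]
    (χ₁ χ₂ dχ₁ dχ₂ : ℝ → Y)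
    (hχ₁ : ∀ t : ℝ, HasDerivAt χ₁ (dχ₁ t) t)
    (hχ₂ : ∀ t : ℝ, HasDerivAt χ₂ (dχ₂ t) t)
    (H₁ H₂ : ℝ → ℝ) (ε₁ ε₂ ν₁ ν₂ : ℝ → Y)
    (hH₁ : ∀ t : ℝ, HasDerivAt H₁ ⟪ε₁ t, dχ₁ t⟫ t)
    (hH₂ : ∀ t : ℝ, HasDerivAt H₂ ⟪ε₂ t, dχ₂ t⟫ t)
    (φT : Y × Y → ℝ) (g₁ g₂ : Y → Y → Y)
    (hφT : ∀ a b : Y, HasFDerivAt φT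
      ((innerSL ℝ (g₁ a b)).comp (ContinuousLinearMap.fst ℝ Y Y)
        + (innerSL ℝ (g₂ a b)).comp (ContinuousLinearMap.snd ℝ Y Y)) (a, b))
    (hint₁ : ∀ t : ℝ, ε₁ t = -g₁ (χ₁ t) (χ₂ t) + ν₁ t)
    (hint₂ : ∀ t : ℝ, ε₂ t = -g₂ (χ₁ t) (χ₂ t) + ν₂ t) :
    ∀ t : ℝ,
      HasDerivAt (fun u => H₁ u + H₂ u + φT (χ₁ u, χ₂ u))
        (⟪ν₁ t, dχ₁ t⟫ + ⟪ν₂ t, dχ₂ t⟫) t := by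
  intro t
  have hφ := (hφT (χ₁ t) (χ₂ t)).comp_hasDerivAt t ((hχ₁ t).prodMk (hχ₂ t))
  refine (((hH₁ t).add (hH₂ t)).add hφ).congr_deriv ?_
  simp only [hint₁, hint₂, inner_add_left, inner_neg_left, add_apply,
    ContinuousLinearMap.comp_apply, ContinuousLinearMap.coe_fst', ContinuousLinearMap.coe_snd',
    innerSL_apply_apply]
  ring
end

section
/- Let ρ, h > 0 be constants and let 𝔻 be a linear map on 2×2 real matrices that is symmetric for the Frobenius inner product (𝔻A : B = A : 𝔻B for all 2×2 matrices A, B). Let w, p : ℝ × ℝ² → ℝ be smooth, with w(t,·) and p(t,·) supported in a fixed compact set K ⊆ ℝ² for all t, and assume the Kirchhoff–Love dynamics: ∂ₜw(t,x) = p(t,x)/(ρh) and ∂ₜp(t,x) = −div( Div( 𝔻(Hess w) ) )(t,x), where Hess w is the spatial Hessian matrix of w, (Div T)_i := Σⱼ ∂ⱼ T_{ij}, and div is the scalar divergence of a vector field. Then the Hamiltonian H(t) := (1/2) ∫_{ℝ²} ( p(t,x)²/(ρh) + (Hess w)(t,x) : 𝔻(Hess w)(t,x) ) dx is constant in t. 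-/
open MeasureTheory

/-- The Hessian matrix of a scalar field on `ℝ²`: `(hess2 w x) i j = ∂ᵢ∂ⱼ w (x)`. -/
noncomputable def hess2 (w : EuclideanSpace ℝ (Fin 2) → ℝ)
    (x : EuclideanSpace ℝ (Fin 2)) : Matrix (Fin 2) (Fin 2) ℝ :=
  Matrix.of fun i j =>
    fderiv ℝ (fun y => fderiv ℝ w y (EuclideanSpace.single j 1)) x (EuclideanSpace.single i 1)

open Set Filter Topology
open scoped ContDiff

/-- Differentiation under the integral sign for fields supported in a fixed compact set. -/
theorem hasDerivAt_integral_of_support_subset_compact {E : Type*} [NormedAddCommGroup E]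
    [MeasurableSpace E] [BorelSpace E] {μ : Measure E} [IsFiniteMeasureOnCompacts μ]
    {F F' : ℝ → E → ℝ} {K : Set E} (hK : IsCompact K) (hF0 : ∀ t, ∀ x ∉ K, F t x = 0)
    (hF : Continuous (fun q : ℝ × E => F q.1 q.2))
    (hF' : Continuous (fun q : ℝ × E => F' q.1 q.2))
    (hd : ∀ t x, HasDerivAt (fun s => F s x) (F' t x) t) (t : ℝ) :
    HasDerivAt (fun s => ∫ x, F s x ∂μ) (∫ x, F' t x ∂μ) t := by
  have hF'0 : ∀ s, ∀ x ∉ K, F' s x = 0 := by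
    intro s x hx
    have h0 : (fun r => F r x) = fun _ => 0 := funext fun r => hF0 r x hx
    have := hd s x
    rw [h0] at this
    exact this.unique (hasDerivAt_const s 0)
  have hslice : ∀ {H : ℝ → E → ℝ}, Continuous (fun q : ℝ × E => H q.1 q.2) →
      (∀ s, ∀ x ∉ K, H s x = 0) → ∀ s, Integrable (H s) μ := fun hH h0 s =>
    (hH.comp (Continuous.prodMk_right s)).integrable_of_hasCompactSupport
      (HasCompactSupport.intro hK (h0 s))
  obtain ⟨C, hC⟩ := ((isCompact_Icc (a := t - 1) (b := t + 1)).prod hK).exists_bound_of_continuousOn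
    hF'.continuousOn
  refine (hasDerivAt_integral_of_dominated_loc_of_deriv_le (s := Icc (t - 1) (t + 1))
    (bound := K.indicator fun _ => C) (Icc_mem_nhds (by linarith) (by linarith))
    (Eventually.of_forall fun s => (hslice hF hF0 s).aestronglyMeasurable)
    (hslice hF hF0 t) (hslice hF' hF'0 t).aestronglyMeasurable ?_ ?_
    (Eventually.of_forall fun x s _ => hd s x)).2
  · refine Eventually.of_forall fun x s hs => ?_
    by_cases hx : x ∈ K
    · simpa [hx] using hC (s, x) ⟨hs, hx⟩
    · simp [hx, hF'0 s x hx]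
  · exact (integrable_indicator_iff hK.isClosed.measurableSet).2
      (integrableOn_const hK.measure_lt_top.ne)

section TimeDependentFields

variable {E : Type*} [NormedAddCommGroup E] [NormedSpace ℝ E]

/-- Spatial directional derivatives of a jointly smooth field are jointly smooth. -/
theorem contDiff_fderiv_slice_apply {F : ℝ → E → ℝ}
    (hF : ContDiff ℝ ∞ (fun q : ℝ × E => F q.1 q.2)) (v : E) :
    ContDiff ℝ ∞ (fun q : ℝ × E => fderiv ℝ (F q.1) q.2 v) := by
  have hF' : ContDiff ℝ ∞ (Function.uncurry fun (q : ℝ × E) (y : E) => F q.1 y) :=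
    hF.comp (f := fun r : (ℝ × E) × E => (r.1.1, r.2)) (by fun_prop)
  exact hF'.fderiv_apply contDiff_snd contDiff_const (by simp)

/-- A spatial directional derivative of a jointly smooth field commutes with the time
derivative. -/
theorem hasDerivAt_fderiv_slice_apply {F G : ℝ → E → ℝ}
    (hF : ContDiff ℝ ∞ (fun q : ℝ × E => F q.1 q.2))
    (hFG : ∀ t x, HasDerivAt (fun s => F s x) (G t x) t) (v : E) (t : ℝ) (x : E) :
    HasDerivAt (fun s => fderiv ℝ (F s) x v) (fderiv ℝ (G t) x v) t := by
  set Φ : ℝ × E → ℝ := fun q => F q.1 q.2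
  have hd : Differentiable ℝ Φ := hF.differentiable (by simp)
  have hd2 : Differentiable ℝ (fderiv ℝ Φ) :=
    (hF.fderiv_right (m := ∞) (by simp)).differentiable (by simp)
  have hl : ∀ s : ℝ, ∀ y : E, HasDerivAt (fun r : ℝ => (r, y)) ((1 : ℝ), (0 : E)) s :=
    fun s y => (hasDerivAt_id s).prodMk (hasDerivAt_const s y)
  have hr : ∀ s : ℝ, ∀ y : E, HasFDerivAt (fun z : E => (s, z))
      (ContinuousLinearMap.inr ℝ ℝ E) y := fun s y => hasFDerivAt_prodMk_right s y
  have hspace : ∀ s : ℝ, fderiv ℝ (F s) x v = fderiv ℝ Φ (s, x) ((0 : ℝ), v) := by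
    intro s
    have := ((hd (s, x)).hasFDerivAt.comp x (hr s x)).fderiv
    change fderiv ℝ (F s) x = _ at this
    simp [this]
  have htime : G t = fun y => fderiv ℝ Φ (t, y) ((1 : ℝ), (0 : E)) := by
    funext y
    have hy : HasDerivAt (fun s => F s y) (fderiv ℝ Φ (t, y) ((1 : ℝ), (0 : E))) t :=
      HasFDerivAt.comp_hasDerivAt (l := Φ) t (hd (t, y)).hasFDerivAt (hl t y)
    exact (hFG t y).unique hy
  have hmixed : fderiv ℝ (G t) x v
      = fderiv ℝ (fderiv ℝ Φ) (t, x) ((0 : ℝ), v) ((1 : ℝ), (0 : E)) := by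
    have := (((hd2 (t, x)).hasFDerivAt.comp x (hr t x)).clm_apply
      (hasFDerivAt_const ((1 : ℝ), (0 : E)) x)).fderiv
    rw [htime]
    change fderiv ℝ (fun y => fderiv ℝ Φ (t, y) ((1 : ℝ), (0 : E))) x = _ at this
    simp [this]
  have hsymm : IsSymmSndFDerivAt ℝ Φ (t, x) :=
    (contDiff_infty.1 hF 2).contDiffAt.isSymmSndFDerivAt (by simp)
  rw [hmixed, hsymm.eq, funext hspace]
  have hd1 : HasDerivAt (fun s => fderiv ℝ Φ (s, x))
      (fderiv ℝ (fderiv ℝ Φ) (t, x) ((1 : ℝ), (0 : E))) t :=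
    HasFDerivAt.comp_hasDerivAt (l := fderiv ℝ Φ) t (hd2 (t, x)).hasFDerivAt (hl t x)
  simpa using hd1.clm_apply (hasDerivAt_const t ((0 : ℝ), v))

/-- The derivative of a function vanishing outside a closed set vanishes outside that set. -/
theorem fderiv_apply_eq_zero_of_notMem {f : E → ℝ} {K : Set E} (hK : IsClosed K)
    (hf : ∀ x ∉ K, f x = 0) (v : E) : ∀ x ∉ K, fderiv ℝ f x v = 0 := by
  intro x hx
  have : f =ᶠ[𝓝 x] fun _ => 0 := by
    filter_upwards [hK.isOpen_compl.mem_nhds hx] with y hy using hf y hy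
  simp [this.fderiv_eq]

variable [MeasurableSpace E] [BorelSpace E] {μ : Measure E}

/-- Two integrations by parts for smooth functions, one of which is compactly supported. -/
theorem integral_mul_fderiv_fderiv_eq [FiniteDimensional ℝ E] [μ.IsAddHaarMeasure]
    {f g : E → ℝ} (hf : ContDiff ℝ ∞ f) (hg : ContDiff ℝ ∞ g) (hfs : HasCompactSupport f)
    (u v : E) :
    ∫ x, f x * fderiv ℝ (fun y => fderiv ℝ g y v) x u ∂μ
      = ∫ x, fderiv ℝ (fun y => fderiv ℝ f y u) x v * g x ∂μ := by
  have hsm : ∀ {k : E → ℝ}, ContDiff ℝ ∞ k → ∀ z, ContDiff ℝ ∞ (fun y => fderiv ℝ k y z) :=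
    fun hk z => (hk.fderiv_right (m := ∞) (by simp)).clm_apply contDiff_const
  have hint : ∀ {a b : E → ℝ}, ContDiff ℝ ∞ a → ContDiff ℝ ∞ b → HasCompactSupport a →
      Integrable (fun x => a x * b x) μ := fun ha hb has =>
    (ha.continuous.mul hb.continuous).integrable_of_hasCompactSupport has.mul_right
  have hdf := hsm hf u
  have hdg := hsm hg v
  have hdfs : HasCompactSupport (fun y => fderiv ℝ f y u) := hfs.fderiv_apply ℝ u
  have hddfs : HasCompactSupport (fun y => fderiv ℝ (fun y => fderiv ℝ f y u) y v) :=
    hdfs.fderiv_apply ℝ v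
  have hdiff : ∀ {k : E → ℝ}, ContDiff ℝ ∞ k → Differentiable ℝ k :=
    fun hk => hk.differentiable (by simp)
  rw [integral_mul_fderiv_eq_neg_fderiv_mul_of_integrable (hint hdf hdg hdfs)
      (hint hf (hsm hdg u) hfs) (hint hf hdg hfs) (fun x _ => hdiff hf x) (fun x _ => hdiff hdg x),
    integral_mul_fderiv_eq_neg_fderiv_mul_of_integrable (hint (hsm hdf v) hg hddfs)
      (hint hdf hdg hdfs) (hint hdf hg hdfs) (fun x _ => hdiff hdf x) (fun x _ => hdiff hg x),
    neg_neg]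

end TimeDependentFields

section Hessian

theorem linearMap_matrix_apply_eq_sum
    (𝔻 : Matrix (Fin 2) (Fin 2) ℝ →ₗ[ℝ] Matrix (Fin 2) (Fin 2) ℝ)
    (A : Matrix (Fin 2) (Fin 2) ℝ) (i j : Fin 2) :
    (𝔻 A) i j = ∑ k, ∑ l, A k l * (𝔻 (Matrix.single k l 1)) i j := by
  conv_lhs => rw [Matrix.matrix_eq_sum_single A]
  have : ∀ k l, Matrix.single k l (A k l) = A k l • Matrix.single k l (1 : ℝ) := by
    intro k l
    simp [Matrix.smul_single]
  simp only [this, map_sum, map_smul, Matrix.sum_apply, Matrix.smul_apply, smul_eq_mul]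

variable {w g : ℝ → EuclideanSpace ℝ (Fin 2) → ℝ}

theorem hess2_comm {f : EuclideanSpace ℝ (Fin 2) → ℝ} (hf : ContDiff ℝ ∞ f)
    (x : EuclideanSpace ℝ (Fin 2)) (i j : Fin 2) : hess2 f x i j = hess2 f x j i := by
  have hd2 : Differentiable ℝ (fderiv ℝ f) :=
    (hf.fderiv_right (m := ∞) (by simp)).differentiable (by simp)
  have key : ∀ u v, fderiv ℝ (fun y => fderiv ℝ f y v) x u = fderiv ℝ (fderiv ℝ f) x u v := by
    intro u v
    rw [((hd2 x).hasFDerivAt.clm_apply (hasFDerivAt_const v x)).fderiv]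
    simp
  have hsymm : IsSymmSndFDerivAt ℝ f x :=
    (contDiff_infty.1 hf 2).contDiffAt.isSymmSndFDerivAt (by simp)
  simp only [hess2, Matrix.of_apply, key]
  exact hsymm.eq _ _

theorem contDiff_hess2_apply
    (hw : ContDiff ℝ ∞ (fun q : ℝ × EuclideanSpace ℝ (Fin 2) => w q.1 q.2)) (i j : Fin 2) :
    ContDiff ℝ ∞ (fun q : ℝ × EuclideanSpace ℝ (Fin 2) => hess2 (w q.1) q.2 i j) :=
  contDiff_fderiv_slice_apply
    (F := fun t x => fderiv ℝ (w t) x (EuclideanSpace.single j 1))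
    (contDiff_fderiv_slice_apply hw _) (EuclideanSpace.single i 1)

theorem hasDerivAt_hess2_apply
    (hw : ContDiff ℝ ∞ (fun q : ℝ × EuclideanSpace ℝ (Fin 2) => w q.1 q.2))
    (hwg : ∀ t x, HasDerivAt (fun s => w s x) (g t x) t) (t : ℝ) (x : EuclideanSpace ℝ (Fin 2))
    (i j : Fin 2) :
    HasDerivAt (fun s => hess2 (w s) x i j) (hess2 (g t) x i j) t :=
  hasDerivAt_fderiv_slice_apply
    (F := fun t x => fderiv ℝ (w t) x (EuclideanSpace.single j 1))
    (contDiff_fderiv_slice_apply hw (EuclideanSpace.single j 1))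
    (fun t x => hasDerivAt_fderiv_slice_apply hw hwg (EuclideanSpace.single j 1) t x) _ t x

theorem hess2_eq_zero_of_notMem {f : EuclideanSpace ℝ (Fin 2) → ℝ}
    {K : Set (EuclideanSpace ℝ (Fin 2))} (hK : IsClosed K) (hf : ∀ x ∉ K, f x = 0)
    {x : EuclideanSpace ℝ (Fin 2)} (hx : x ∉ K) : hess2 f x = 0 := by
  ext i j
  exact fderiv_apply_eq_zero_of_notMem hK (fderiv_apply_eq_zero_of_notMem hK hf _) _ x hx

theorem contDiff_linearMap_hess2_apply
    (𝔻 : Matrix (Fin 2) (Fin 2) ℝ →ₗ[ℝ] Matrix (Fin 2) (Fin 2) ℝ)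
    (hw : ContDiff ℝ ∞ (fun q : ℝ × EuclideanSpace ℝ (Fin 2) => w q.1 q.2)) (i j : Fin 2) :
    ContDiff ℝ ∞ (fun q : ℝ × EuclideanSpace ℝ (Fin 2) => (𝔻 (hess2 (w q.1) q.2)) i j) := by
  simp_rw [linearMap_matrix_apply_eq_sum 𝔻 (hess2 _ _) i j]
  exact ContDiff.sum fun k _ => ContDiff.sum fun l _ =>
    (contDiff_hess2_apply hw k l).mul contDiff_const

theorem hasDerivAt_linearMap_hess2_apply
    (𝔻 : Matrix (Fin 2) (Fin 2) ℝ →ₗ[ℝ] Matrix (Fin 2) (Fin 2) ℝ)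
    (hw : ContDiff ℝ ∞ (fun q : ℝ × EuclideanSpace ℝ (Fin 2) => w q.1 q.2))
    (hwg : ∀ t x, HasDerivAt (fun s => w s x) (g t x) t) (t : ℝ) (x : EuclideanSpace ℝ (Fin 2))
    (i j : Fin 2) :
    HasDerivAt (fun s => (𝔻 (hess2 (w s) x)) i j) ((𝔻 (hess2 (g t) x)) i j) t := by
  simp_rw [linearMap_matrix_apply_eq_sum 𝔻 (hess2 _ _) i j]
  exact HasDerivAt.fun_sum fun k _ => HasDerivAt.fun_sum fun l _ =>
    (hasDerivAt_hess2_apply hw hwg t x k l).mul_const _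

/-- The double divergence is the formal adjoint of the Hessian. -/
theorem integral_mul_divDiv_eq_integral_hess2_inner {f : EuclideanSpace ℝ (Fin 2) → ℝ}
    {T : EuclideanSpace ℝ (Fin 2) → Matrix (Fin 2) (Fin 2) ℝ} (hf : ContDiff ℝ ∞ f)
    (hfs : HasCompactSupport f) (hT : ∀ i j, ContDiff ℝ ∞ (fun x => T x i j)) :
    ∫ x, f x * ∑ i, ∑ j, fderiv ℝ (fun y => fderiv ℝ (fun y' => T y' i j) y
        (EuclideanSpace.single j 1)) x (EuclideanSpace.single i 1)
      = ∫ x, ∑ i, ∑ j, hess2 f x i j * T x i j := by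
  have hsm : ∀ {k : EuclideanSpace ℝ (Fin 2) → ℝ}, ContDiff ℝ ∞ k →
      ∀ z, ContDiff ℝ ∞ (fun y => fderiv ℝ k y z) :=
    fun hk z => (hk.fderiv_right (m := ∞) (by simp)).clm_apply contDiff_const
  have hl : ∀ i j : Fin 2, Integrable (fun x => f x * fderiv ℝ (fun y =>
      fderiv ℝ (fun y' => T y' i j) y (EuclideanSpace.single j 1)) x
        (EuclideanSpace.single i 1)) := fun i j =>
    (hf.continuous.mul (hsm (hsm (hT i j) _) _).continuous).integrable_of_hasCompactSupport
      hfs.mul_right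
  have hr : ∀ i j : Fin 2, Integrable (fun x => hess2 f x i j * T x i j) := fun i j =>
    ((hsm (hsm hf _) _).continuous.mul (hT i j).continuous).integrable_of_hasCompactSupport
      ((hfs.fderiv_apply ℝ (EuclideanSpace.single j 1)).fderiv_apply ℝ
        (EuclideanSpace.single i 1)).mul_right
  simp_rw [Finset.mul_sum]
  rw [integral_finsetSum _ fun i _ => integrable_finsetSum _ fun j _ => hl i j,
    integral_finsetSum _ fun i _ => integrable_finsetSum _ fun j _ => hr i j]
  refine Finset.sum_congr rfl fun i _ => ?_
  rw [integral_finsetSum _ fun j _ => hl i j, integral_finsetSum _ fun j _ => hr i j]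
  refine Finset.sum_congr rfl fun j _ => ?_
  rw [integral_mul_fderiv_fderiv_eq hf (hT i j) hfs]
  refine integral_congr_ae (Eventually.of_forall fun x => ?_)
  simp only [hess2_comm hf x i j]
  rfl

end Hessian

/-- Energy conservation for the Kirchhoff–Love thin plate model with spatially compactly
supported smooth solutions: if `∂ₜw = p/(ρh)` and `∂ₜp = −div(Div(𝔻(Hess w)))` with `𝔻`
symmetric for the Frobenius inner product, then the Hamiltonian
`H(t) = (1/2)∫ (p²/(ρh) + Hess w : 𝔻(Hess w))` is constant in time. -/
theorem kirchhoff_love_energy_conservation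
    (ρ h : ℝ) (hρ : 0 < ρ) (hh : 0 < h)
    (𝔻 : Matrix (Fin 2) (Fin 2) ℝ →ₗ[ℝ] Matrix (Fin 2) (Fin 2) ℝ)
    (h𝔻 : ∀ A B : Matrix (Fin 2) (Fin 2) ℝ,
      ∑ i, ∑ j, (𝔻 A) i j * B i j = ∑ i, ∑ j, A i j * (𝔻 B) i j)
    (w p : ℝ → EuclideanSpace ℝ (Fin 2) → ℝ)
    (hw : ContDiff ℝ (⊤ : ℕ∞) (fun q : ℝ × EuclideanSpace ℝ (Fin 2) => w q.1 q.2))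
    (hp : ContDiff ℝ (⊤ : ℕ∞) (fun q : ℝ × EuclideanSpace ℝ (Fin 2) => p q.1 q.2))
    (K : Set (EuclideanSpace ℝ (Fin 2))) (hK : IsCompact K)
    (hws : ∀ t x, x ∉ K → w t x = 0)
    (hps : ∀ t x, x ∉ K → p t x = 0)
    (hdyn1 : ∀ (t : ℝ) (x : EuclideanSpace ℝ (Fin 2)),
      HasDerivAt (fun s => w s x) (p t x / (ρ * h)) t)
    (hdyn2 : ∀ (t : ℝ) (x : EuclideanSpace ℝ (Fin 2)),
      HasDerivAt (fun s => p s x)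
        (-(∑ i, ∑ j,
          fderiv ℝ (fun y =>
              fderiv ℝ (fun y' => (𝔻 (hess2 (w t) y')) i j) y (EuclideanSpace.single j 1))
            x (EuclideanSpace.single i 1))) t) :
    ∀ t₁ t₂ : ℝ,
      ((1/2) * ∫ x : EuclideanSpace ℝ (Fin 2),
        ((p t₁ x)^2 / (ρ * h) + ∑ i, ∑ j, (hess2 (w t₁) x) i j * (𝔻 (hess2 (w t₁) x)) i j))
      = (1/2) * ∫ x : EuclideanSpace ℝ (Fin 2),
        ((p t₂ x)^2 / (ρ * h) + ∑ i, ∑ j, (hess2 (w t₂) x) i j * (𝔻 (hess2 (w t₂) x)) i j) := by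
  have hc : ρ * h ≠ 0 := (mul_pos hρ hh).ne'
  set g : ℝ → EuclideanSpace ℝ (Fin 2) → ℝ := fun t x => p t x / (ρ * h) with hg
  have hgsm : ContDiff ℝ ∞ (fun q : ℝ × EuclideanSpace ℝ (Fin 2) => g q.1 q.2) :=
    hp.div_const _
  set T : ℝ → EuclideanSpace ℝ (Fin 2) → Matrix (Fin 2) (Fin 2) ℝ :=
    fun t x => 𝔻 (hess2 (w t) x)
  have hT : ∀ i j, ContDiff ℝ ∞ (fun q : ℝ × EuclideanSpace ℝ (Fin 2) => T q.1 q.2 i j) :=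
    fun i j => contDiff_linearMap_hess2_apply 𝔻 hw i j
  set q : ℝ → EuclideanSpace ℝ (Fin 2) → ℝ := fun t x =>
    ∑ i, ∑ j, fderiv ℝ (fun y => fderiv ℝ (fun y' => T t y' i j) y
      (EuclideanSpace.single j 1)) x (EuclideanSpace.single i 1)
  have hqsm : ContDiff ℝ ∞ (fun r : ℝ × EuclideanSpace ℝ (Fin 2) => q r.1 r.2) :=
    ContDiff.sum fun i _ => ContDiff.sum fun j _ =>
      contDiff_fderiv_slice_apply
        (F := fun t x => fderiv ℝ (fun y => T t y i j) x (EuclideanSpace.single j 1))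
        (contDiff_fderiv_slice_apply (F := fun t x => T t x i j) (hT i j) _)
        (EuclideanSpace.single i 1)
  have hH : ∀ i j, Continuous
      (fun r : ℝ × EuclideanSpace ℝ (Fin 2) => hess2 (w r.1) r.2 i j) :=
    fun i j => (contDiff_hess2_apply hw i j).continuous
  have hHg : ∀ i j, Continuous
      (fun r : ℝ × EuclideanSpace ℝ (Fin 2) => hess2 (g r.1) r.2 i j) :=
    fun i j => (contDiff_hess2_apply hgsm i j).continuous
  have hTc : ∀ i j, Continuous (fun r : ℝ × EuclideanSpace ℝ (Fin 2) => T r.1 r.2 i j) :=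
    fun i j => (hT i j).continuous
  have hpc := hp.continuous
  have hgc := hgsm.continuous
  have hqc := hqsm.continuous
  have hderiv : ∀ t x, HasDerivAt
      (fun s => (p s x) ^ 2 / (ρ * h) + ∑ i, ∑ j, hess2 (w s) x i j * T s x i j)
      (2 * (∑ i, ∑ j, hess2 (g t) x i j * T t x i j - g t x * q t x)) t := by
    intro t x
    have h1 := ((hdyn2 t x).pow 2).div_const (ρ * h)
    have h2 := HasDerivAt.fun_sum (u := Finset.univ) fun (i : Fin 2) _ =>
      HasDerivAt.fun_sum (u := Finset.univ) fun (j : Fin 2) _ =>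
      (hasDerivAt_hess2_apply hw hdyn1 t x i j).mul
        (hasDerivAt_linearMap_hess2_apply 𝔻 hw hdyn1 t x i j)
    refine (h1.add h2).congr_deriv ?_
    have hsym := h𝔻 (hess2 (g t) x) (hess2 (w t) x)
    have hsym' : ∑ i, ∑ j, hess2 (w t) x i j * (𝔻 (hess2 (g t) x)) i j
        = ∑ i, ∑ j, hess2 (g t) x i j * T t x i j := by
      rw [← hsym]
      simp only [mul_comm]
    simp only [Finset.sum_add_distrib]
    change _ + (∑ i, ∑ j, hess2 (g t) x i j * T t x i j
      + ∑ i, ∑ j, hess2 (w t) x i j * (𝔻 (hess2 (g t) x)) i j) = _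
    rw [hsym']
    change ((2 : ℕ) * p t x ^ (2 - 1) * -(q t x)) / (ρ * h) + _ = _
    simp only [hg]
    field_simp
    ring
  have hgs : ∀ t, HasCompactSupport (g t) := fun t =>
    HasCompactSupport.intro hK fun x hx => by simp [hg, hps t x hx]
  have hpower : ∀ t, ∫ x, 2 * (∑ i, ∑ j, hess2 (g t) x i j * T t x i j - g t x * q t x) = 0 := by
    intro t
    have hslice : ContDiff ℝ ∞ fun x : EuclideanSpace ℝ (Fin 2) => (t, x) := by fun_prop
    have hHgt : ∀ i j, Continuous fun x => hess2 (g t) x i j :=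
      fun i j => (hHg i j).comp hslice.continuous
    have hTt : ∀ i j, Continuous fun x => T t x i j := fun i j => (hTc i j).comp hslice.continuous
    have hadj : ∫ x, g t x * q t x = ∫ x, ∑ i, ∑ j, hess2 (g t) x i j * T t x i j :=
      integral_mul_divDiv_eq_integral_hess2_inner (hgsm.comp hslice) (hgs t)
        (fun i j => (hT i j).comp hslice)
    rw [integral_const_mul, integral_sub, hadj]
    · simp
    · refine Continuous.integrable_of_hasCompactSupport (by fun_prop)
        (HasCompactSupport.intro hK fun x hx => ?_)
      rw [hess2_eq_zero_of_notMem hK.isClosed (fun y hy => by simp [hg, hps t y hy]) hx]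
      simp
    · exact ((hgsm.comp hslice).continuous.mul
        (hqsm.comp hslice).continuous).integrable_of_hasCompactSupport (hgs t).mul_right
  have henergy : ∀ t, HasDerivAt (fun s => ∫ x : EuclideanSpace ℝ (Fin 2),
      ((p s x) ^ 2 / (ρ * h) + ∑ i, ∑ j, hess2 (w s) x i j * T s x i j)) 0 t := by
    intro t
    rw [← hpower t]
    refine hasDerivAt_integral_of_support_subset_compact hK (fun s x hx => ?_) (by fun_prop)
      (by fun_prop) hderiv t
    rw [hess2_eq_zero_of_notMem hK.isClosed (hws s) hx, hps s x hx]
    simp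
  intro t₁ t₂
  exact congrArg (1 / 2 * ·) (is_const_of_deriv_eq_zero
    (fun t => (henergy t).differentiableAt) (fun t => (henergy t).deriv) t₁ t₂)
end
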